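/- arXiv:2101.09732 — 3 statements merged into one kernel-verified Lean document; each statement's English description precedes it below -/
import Mathlib

section
/- Assume additionally that φ ∈ C¹([−d,0];ℝ) with φ(−d) = 0. Then the unique continuous solution (g,h) of system (★) satisfies: g restricted to [0,τ_R] is C¹, h restricted to [0,τ_R]×[−d,0] is C¹, and the following hold: g′(t) − β g(t) + h(t,0) + 1 = 0 for all t ∈ [0,τ_R); −(r+δ) h(t,ζ) + ∂_t h(t,ζ) − ∂_ζ h(t,ζ) + g(t) φ(ζ) = 0 for all t ∈ (0,τ_R) and ζ ∈ (−d,0); g(t) = 0 for all t ≥ τ_R; h(t,ζ) = 0 for all t ≥ τ_R and ζ ∈ [−d,0]; and h(t,−d) = 0 for all t ≥ 0. -/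
open MeasureTheory Set

/-- The pair `(g, h)` solves system (★). -/
def SolvesStar (d τR β r δ : ℝ) (φ g : ℝ → ℝ) (h : ℝ → ℝ → ℝ) : Prop :=
  (∀ t : ℝ, 0 ≤ t →
      g t = if t < τR then (∫ τ in t..τR, Real.exp (-(β * (τ - t))) * (h τ 0 + 1)) else 0) ∧
  (∀ t ζ : ℝ, 0 ≤ t → ζ ∈ Icc (-d) 0 →
      h t ζ = if t < τR then
          (∫ τ in (max (ζ + t - τR) (-d))..ζ,
            Real.exp (-((r + δ) * (ζ - τ))) * g (t + ζ - τ) * φ τ)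
        else 0)

/-- `g` is continuous on `[0,∞)` and `h` is continuous on `[0,∞) × [-d,0]`. -/
def ContSol (d : ℝ) (g : ℝ → ℝ) (h : ℝ → ℝ → ℝ) : Prop :=
  ContinuousOn g (Ici 0) ∧
  ContinuousOn (fun p : ℝ × ℝ => h p.1 p.2) (Ici 0 ×ˢ Icc (-d) 0)

open Filter Topology

/-- Differentiation of an interval integral with respect to a parameter, for a jointly continuous
derivative. -/
lemma hasDerivAt_intervalIntegral_of_continuous {F F' : ℝ → ℝ → ℝ}
    (hF : Continuous (Function.uncurry F)) (hF' : Continuous (Function.uncurry F'))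
    (hd : ∀ x u, HasDerivAt (fun y => F y u) (F' x u) x) (a b x : ℝ) :
    HasDerivAt (fun y => ∫ u in a..b, F y u) (∫ u in a..b, F' x u) x := by
  have hc : ∀ y, Continuous (F y) := fun y => hF.comp (by fun_prop : Continuous fun u => (y, u))
  have hc' : ∀ y, Continuous (F' y) :=
    fun y => hF'.comp (by fun_prop : Continuous fun u => (y, u))
  obtain ⟨C, hC⟩ := ((isCompact_closedBall x 1).prod (isCompact_uIcc (a := a) (b := b))
    ).exists_bound_of_continuousOn hF'.continuousOn
  refine (intervalIntegral.hasDerivAt_integral_of_dominated_loc_of_deriv_le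
    (bound := fun _ => C) (Metric.closedBall_mem_nhds x one_pos)
    (Eventually.of_forall fun y => (hc y).aestronglyMeasurable)
    ((hc x).intervalIntegrable a b) (hc' x).aestronglyMeasurable ?_ intervalIntegrable_const
    (Eventually.of_forall fun u _ y _ => hd y u)).2
  exact Eventually.of_forall fun u hu y hy => hC (y, u) ⟨hy, uIoc_subset_uIcc hu⟩

/-- A truncated convolution of a continuous function with a `C¹` function is jointly `C¹` in the
truncation point and the argument. -/
lemma hasStrictFDerivAt_truncated_convolution {K Φ ψ : ℝ → ℝ} (hK : Continuous K)
    (hψ : Continuous ψ) (hΦ : ∀ x, HasDerivAt Φ (ψ x) x) (p : ℝ × ℝ) :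
    HasStrictFDerivAt (fun q : ℝ × ℝ => ∫ u in (0 : ℝ)..q.1, K u * Φ (q.2 - u))
      ((ContinuousLinearMap.toSpanSingleton ℝ (K p.1 * Φ (p.2 - p.1))).coprod
        (ContinuousLinearMap.toSpanSingleton ℝ (∫ u in (0 : ℝ)..p.1, K u * ψ (p.2 - u)))) p := by
  have hΦc : Continuous Φ := continuous_iff_continuousAt.2 fun x => (hΦ x).continuousAt
  have hcont : ∀ x, Continuous fun u => K u * Φ (x - u) := fun x => by fun_prop
  have hprim : Continuous fun q : ℝ × ℝ => ∫ u in (0 : ℝ)..q.1, K u * ψ (q.2 - u) :=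
    intervalIntegral.continuous_parametric_intervalIntegral_of_continuous
      (f := fun (q : ℝ × ℝ) u => K u * ψ (q.2 - u)) (by fun_prop) continuous_fst
  have hspan : Continuous fun c : ℝ => ContinuousLinearMap.toSpanSingleton ℝ c :=
    (ContinuousLinearMap.toSpanSingletonCLE (𝕜 := ℝ) (E := ℝ)).continuous
  refine hasStrictFDerivAt_uncurry_coprod (𝕜 := ℝ)
    (f := fun b x => ∫ u in (0 : ℝ)..b, K u * Φ (x - u))
    (f₁ := fun b x => ContinuousLinearMap.toSpanSingleton ℝ (K b * Φ (x - b)))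
    (f₂ := fun b x => ContinuousLinearMap.toSpanSingleton ℝ (∫ u in (0 : ℝ)..b, K u * ψ (x - u)))
    (Eventually.of_forall fun v => ?_) (Eventually.of_forall fun v => ?_)
    (hspan.comp (by fun_prop : Continuous fun q : ℝ × ℝ => K q.1 * Φ (q.2 - q.1))).continuousAt
    (hspan.comp hprim).continuousAt
  · exact ((hcont v.2).integral_hasStrictDerivAt 0 v.1).hasDerivAt.hasFDerivAt
  · refine (hasDerivAt_intervalIntegral_of_continuous
      (F := fun x u => K u * Φ (x - u)) (F' := fun x u => K u * ψ (x - u))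
      (by unfold Function.uncurry; fun_prop) (by unfold Function.uncurry; fun_prop)
      (fun x u => ?_) 0 v.1 v.2).hasFDerivAt
    exact ((hΦ (x - u)).comp_sub_const x u).const_mul (K u)

lemma contDiff_truncated_convolution {K Φ : ℝ → ℝ} (hK : Continuous K) (hΦ : ContDiff ℝ 1 Φ) :
    ContDiff ℝ 1 (fun q : ℝ × ℝ => ∫ u in (0 : ℝ)..q.1, K u * Φ (q.2 - u)) := by
  obtain ⟨hdiff, hψ⟩ := contDiff_one_iff_deriv.1 hΦ
  have hstrict := hasStrictFDerivAt_truncated_convolution hK hψ fun x => (hdiff x).hasDerivAt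
  have hspan : Continuous fun c : ℝ => ContinuousLinearMap.toSpanSingleton ℝ c :=
    (ContinuousLinearMap.toSpanSingletonCLE (𝕜 := ℝ) (E := ℝ)).continuous
  have hΦc := hΦ.continuous
  have hprim : Continuous fun q : ℝ × ℝ => ∫ u in (0 : ℝ)..q.1, K u * deriv Φ (q.2 - u) :=
    intervalIntegral.continuous_parametric_intervalIntegral_of_continuous
      (f := fun (q : ℝ × ℝ) u => K u * deriv Φ (q.2 - u)) (by fun_prop) continuous_fst
  have hmul : Continuous fun q : ℝ × ℝ => K q.1 * Φ (q.2 - q.1) := by fun_prop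
  exact contDiff_one_iff_hasFDerivAt.2 ⟨_,
    (ContinuousLinearMap.coprodEquivL (S := ℝ)).continuous.comp
      ((hspan.comp hmul).prodMk (hspan.comp hprim)), fun p => (hstrict p).hasFDerivAt⟩

/-- A `C¹` function on a compact interval extends to a `C¹` function on the line. -/
lemma ContDiffOn.exists_contDiff_eqOn_Icc {f : ℝ → ℝ} {a b : ℝ} (hab : a < b)
    (hf : ContDiffOn ℝ 1 f (Icc a b)) : ∃ F : ℝ → ℝ, ContDiff ℝ 1 F ∧ EqOn F f (Icc a b) := by
  have hud := uniqueDiffOn_Icc hab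
  have hc : ContinuousOn (derivWithin f (Icc a b)) (Icc a b) :=
    hf.continuousOn_derivWithin hud le_rfl
  set ψ : ℝ → ℝ := IccExtend hab.le ((Icc a b).domRestrict (derivWithin f (Icc a b))) with hψdef
  have hψ : Continuous ψ := (continuousOn_iff_continuous_domRestrict.1 hc).Icc_extend'
  have hderiv : ∀ x, HasDerivAt (fun x => f a + ∫ u in a..x, ψ u) (ψ x) x := fun x =>
    (hψ.integral_hasStrictDerivAt a x).hasDerivAt.const_add (f a)
  refine ⟨fun x => f a + ∫ u in a..x, ψ u, contDiff_one_iff_deriv.2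
    ⟨fun x => (hderiv x).differentiableAt, ?_⟩, fun x hx => ?_⟩
  · rwa [funext fun x => (hderiv x).deriv]
  · have hftc : ∫ u in a..x, ψ u = f x - f a := by
      refine intervalIntegral.integral_eq_sub_of_hasDerivAt_of_le hx.1
        (hf.continuousOn.mono (Icc_subset_Icc_right hx.2)) (fun u hu => ?_)
        (hψ.intervalIntegrable a x)
      have hu' : u ∈ Ioo a b := ⟨hu.1, hu.2.trans_le hx.2⟩
      have hnhds : Icc a b ∈ 𝓝 u := Icc_mem_nhds hu'.1 hu'.2
      have hval : ψ u = derivWithin f (Icc a b) u := by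
        rw [hψdef, IccExtend_of_mem _ _ (Ioo_subset_Icc_self hu')]
        rfl
      rw [hval]
      exact ((hf.differentiableOn one_ne_zero u (Ioo_subset_Icc_self hu')).hasDerivWithinAt
        ).hasDerivAt hnhds
    simp [hftc]

/-- The function `h` expressed through the truncated convolution of `K(u) = e^{-c u} g(u)`
and `Φ`. -/
noncomputable def convolutionForm (c d : ℝ) (K Φ : ℝ → ℝ) (p : ℝ × ℝ) : ℝ :=
  Real.exp (c * p.1) * ((∫ u in (0 : ℝ)..(p.1 + p.2 + d), K u * Φ (p.1 + p.2 - u)) -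
    ∫ u in (0 : ℝ)..p.1, K u * Φ (p.1 + p.2 - u))

lemma contDiff_convolutionForm (c d : ℝ) {K Φ : ℝ → ℝ} (hK : Continuous K)
    (hΦ : ContDiff ℝ 1 Φ) : ContDiff ℝ 1 (convolutionForm c d K Φ) := by
  have hQ := contDiff_truncated_convolution hK hΦ
  have hupper := hQ.comp (by fun_prop : ContDiff ℝ 1 fun p : ℝ × ℝ => (p.1 + p.2 + d, p.1 + p.2))
  have hlower := hQ.comp (by fun_prop : ContDiff ℝ 1 fun p : ℝ × ℝ => (p.1, p.1 + p.2))
  have hexp : ContDiff ℝ 1 fun p : ℝ × ℝ => Real.exp (c * p.1) := by fun_prop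
  exact hexp.mul (hupper.sub hlower)

/-- The transport equation satisfied by `convolutionForm`. -/
lemma convolutionForm_transport (c d : ℝ) {K Φ : ℝ → ℝ} (hK : Continuous K)
    (hΦ : ContDiff ℝ 1 Φ) (t ζ : ℝ) : ∃ ht hζ : ℝ,
      HasDerivAt (fun s => convolutionForm c d K Φ (s, ζ)) ht t ∧
      HasDerivAt (fun z => convolutionForm c d K Φ (t, z)) hζ ζ ∧
      ht - hζ = c * convolutionForm c d K Φ (t, ζ) - Real.exp (c * t) * (K t * Φ ζ) := by
  obtain ⟨hdiff, hψ⟩ := contDiff_one_iff_deriv.1 hΦ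
  have hQ := fun p => (hasStrictFDerivAt_truncated_convolution hK hψ
    fun x => (hdiff x).hasDerivAt) p |>.hasFDerivAt
  have hid := hasDerivAt_id' t
  have hid' := hasDerivAt_id' ζ
  have h1 := (hQ (t + ζ + d, t + ζ)).comp_hasDerivAt t
    (((hid.add_const ζ).add_const d).prodMk (hid.add_const ζ))
  have h2 := (hQ (t, t + ζ)).comp_hasDerivAt t (hid.prodMk (hid.add_const ζ))
  have h3 := (hQ (t + ζ + d, t + ζ)).comp_hasDerivAt ζ
    (((hid'.const_add t).add_const d).prodMk (hid'.const_add t))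
  have h4 := (hQ (t, t + ζ)).comp_hasDerivAt ζ
    ((hasDerivAt_const ζ t).prodMk (hid'.const_add t))
  have hexp : HasDerivAt (fun s => Real.exp (c * s)) (Real.exp (c * t) * (c * 1)) t :=
    (hid.const_mul c).exp
  refine ⟨_, _, hexp.mul (h1.sub h2), (h3.sub h4).const_mul (Real.exp (c * t)), ?_⟩
  simp only [convolutionForm, ContinuousLinearMap.coprod_apply,
    ContinuousLinearMap.toSpanSingleton_apply, smul_eq_mul, add_sub_cancel_left]
  ring

lemma SolvesStar.g_eq_zero {d τR β r δ : ℝ} {φ g : ℝ → ℝ} {h : ℝ → ℝ → ℝ} (hτR : 0 ≤ τR)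
    (hsol : SolvesStar d τR β r δ φ g h) {t : ℝ} (ht : τR ≤ t) : g t = 0 := by
  rw [hsol.1 t (hτR.trans ht), if_neg ht.not_gt]

lemma SolvesStar.h_eq_zero {d τR β r δ : ℝ} {φ g : ℝ → ℝ} {h : ℝ → ℝ → ℝ} (hτR : 0 ≤ τR)
    (hsol : SolvesStar d τR β r δ φ g h) {t ζ : ℝ} (ht : τR ≤ t) (hζ : ζ ∈ Icc (-d) 0) :
    h t ζ = 0 := by
  rw [hsol.2 t ζ (hτR.trans ht) hζ, if_neg ht.not_gt]

lemma SolvesStar.h_neg_d {d τR β r δ : ℝ} {φ g : ℝ → ℝ} {h : ℝ → ℝ → ℝ} (hd : 0 ≤ d)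
    (hsol : SolvesStar d τR β r δ φ g h) {t : ℝ} (ht : 0 ≤ t) : h t (-d) = 0 := by
  rw [hsol.2 t (-d) ht ⟨le_rfl, by linarith⟩]
  split_ifs with hlt
  · rw [max_eq_right (by linarith), intervalIntegral.integral_same]
  · rfl

lemma SolvesStar.h_eq_convolutionForm {d τR β r δ : ℝ} {φ g Φ : ℝ → ℝ} {h : ℝ → ℝ → ℝ}
    (hτR : 0 ≤ τR) (hsol : SolvesStar d τR β r δ φ g h) (hg : ContinuousOn g (Ici 0))
    (hΦ : Continuous Φ) (hΦφ : EqOn Φ φ (Icc (-d) 0)) {t ζ : ℝ} (ht : 0 ≤ t)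
    (hζ : ζ ∈ Icc (-d) 0) :
    h t ζ = convolutionForm (r + δ) d
      (fun u => Real.exp (-((r + δ) * u)) * g (max u 0)) Φ (t, ζ) := by
  set c := r + δ with hc
  have hG : Continuous fun u => g (max u 0) :=
    hg.comp_continuous (by fun_prop) fun u => le_max_right u 0
  have hform : convolutionForm c d (fun u => Real.exp (-(c * u)) * g (max u 0)) Φ (t, ζ) =
      ∫ τ in (-d)..ζ, Real.exp (-(c * (ζ - τ))) * g (max (t + ζ - τ) 0) * Φ τ := by
    have hcont : Continuous fun u => Real.exp (-(c * u)) * g (max u 0) * Φ (t + ζ - u) :=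
      ((by fun_prop : Continuous fun u => Real.exp (-(c * u))).mul hG).mul (by fun_prop)
    have hsub := intervalIntegral.integral_comp_sub_left (a := -d) (b := ζ)
      (fun u => Real.exp (c * t) * (Real.exp (-(c * u)) * g (max u 0) * Φ (t + ζ - u))) (t + ζ)
    simp only [add_sub_cancel_right, sub_neg_eq_add, intervalIntegral.integral_const_mul] at hsub
    rw [convolutionForm, intervalIntegral.integral_interval_sub_left
      (hcont.intervalIntegrable _ _) (hcont.intervalIntegrable _ _)]
    refine hsub.symm.trans ?_
    rw [← intervalIntegral.integral_const_mul]
    refine intervalIntegral.integral_congr fun τ _ => ?_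
    have hexp : Real.exp (-(c * (ζ - τ))) = Real.exp (c * t) * Real.exp (-(c * (t + ζ - τ))) := by
      rw [← Real.exp_add]
      ring_nf
    simp only [hexp, sub_sub_cancel]
    ring
  have hcont : Continuous fun τ =>
      Real.exp (-(c * (ζ - τ))) * g (max (t + ζ - τ) 0) * Φ τ :=
    ((by fun_prop : Continuous fun τ => Real.exp (-(c * (ζ - τ)))).mul
      (hG.comp (by fun_prop : Continuous fun τ => t + ζ - τ))).mul hΦ
  have hvanish : ∀ τ, τ ≤ ζ + t - τR → g (max (t + ζ - τ) 0) = 0 := fun τ hτ =>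
    hsol.g_eq_zero hτR (le_max_of_le_left (by linarith))
  rw [hform, hsol.2 t ζ ht hζ]
  split_ifs with hlt
  · have hle : max (ζ + t - τR) (-d) ≤ ζ := max_le (by linarith) hζ.1
    have hzero : ∫ τ in (-d)..(max (ζ + t - τR) (-d)),
        Real.exp (-(c * (ζ - τ))) * g (max (t + ζ - τ) 0) * Φ τ = 0 := by
      rcases le_total (ζ + t - τR) (-d) with hcase | hcase
      · rw [max_eq_right hcase, intervalIntegral.integral_same]
      · refine intervalIntegral.integral_zero_ae (Eventually.of_forall fun τ hτ => ?_)
        rw [max_eq_left hcase, uIoc_of_le hcase] at hτ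
        simp [hvanish τ hτ.2]
    rw [← intervalIntegral.integral_add_adjacent_intervals (hcont.intervalIntegrable (-d) _)
      (hcont.intervalIntegrable (max (ζ + t - τR) (-d)) ζ), hzero, zero_add]
    refine intervalIntegral.integral_congr fun τ hτ => ?_
    rw [uIcc_of_le hle] at hτ
    have hτζ := hτ.2
    have hdτ := (le_max_right _ _).trans hτ.1
    simp only [← hc, hΦφ ⟨hdτ, hτζ.trans hζ.2⟩, max_eq_left (by linarith : 0 ≤ t + ζ - τ)]
  · symm
    refine intervalIntegral.integral_zero_ae (Eventually.of_forall fun τ hτ => ?_)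
    rw [uIoc_of_le hζ.1] at hτ
    have hτζ := hτ.2
    simp [hvanish τ (by linarith)]

/-- The function `g` has a globally `C¹` extension which satisfies the expected equation. -/
lemma SolvesStar.exists_g_extension {d τR β r δ : ℝ} {φ g : ℝ → ℝ} {h : ℝ → ℝ → ℝ}
    (hsol : SolvesStar d τR β r δ φ g h) (hh : ContinuousOn (fun t => h t 0) (Ici 0)) :
    ∃ G : ℝ → ℝ, ContDiff ℝ 1 G ∧ EqOn g G (Icc 0 τR) ∧
      ∀ t ∈ Icc 0 τR, HasDerivAt G (β * g t - (h t 0 + 1)) t := by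
  have hm : Continuous fun u => h (max u 0) 0 :=
    hh.comp_continuous (by fun_prop) fun u => le_max_right u 0
  have hf : Continuous fun u => Real.exp (-(β * u)) * (h (max u 0) 0 + 1) :=
    (by fun_prop : Continuous fun u => Real.exp (-(β * u))).mul (hm.add_const 1)
  set G : ℝ → ℝ := fun t =>
    Real.exp (β * t) * ∫ u in t..τR, Real.exp (-(β * u)) * (h (max u 0) 0 + 1) with hGdef
  have hderiv : ∀ t, HasDerivAt G (β * G t - (h (max t 0) 0 + 1)) t := fun t => by
    have hprim := intervalIntegral.integral_hasDerivAt_left (hf.intervalIntegrable t τR)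
      hf.aestronglyMeasurable.stronglyMeasurableAtFilter hf.continuousAt
    have hexp : HasDerivAt (fun s => Real.exp (β * s)) (Real.exp (β * t) * (β * 1)) t :=
      ((hasDerivAt_id' t).const_mul β).exp
    refine (hexp.mul hprim).congr_deriv ?_
    have hone : Real.exp (β * t) * Real.exp (-(β * t)) = 1 := by
      rw [← Real.exp_add, add_neg_cancel, Real.exp_zero]
    simp only [hGdef]
    linear_combination (-(h (max t 0) 0 + 1)) * hone
  have heq : EqOn g G (Icc 0 τR) := fun t ht => by
    rw [hsol.1 t ht.1]
    split_ifs with hlt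
    · simp only [hGdef]
      rw [← intervalIntegral.integral_const_mul]
      refine intervalIntegral.integral_congr fun τ hτ => ?_
      rw [uIcc_of_le ht.2] at hτ
      have hexp : Real.exp (-(β * (τ - t))) = Real.exp (β * t) * Real.exp (-(β * τ)) := by
        rw [← Real.exp_add]
        ring_nf
      simp only [hexp, max_eq_left (ht.1.trans hτ.1)]
      ring
    · simp [hGdef, le_antisymm ht.2 (not_lt.1 hlt)]
  have hGc : Continuous G := continuous_iff_continuousAt.2 fun t => (hderiv t).continuousAt
  refine ⟨G, contDiff_one_iff_deriv.2 ⟨fun t => (hderiv t).differentiableAt, ?_⟩, heq,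
    fun t ht => ?_⟩
  · rw [funext fun t => (hderiv t).deriv]
    exact (hGc.const_mul β).sub (hm.add_const 1)
  · simpa only [heq ht, max_eq_left ht.1] using hderiv t

/-- If moreover `φ ∈ C¹([-d,0];ℝ)` with `φ(-d) = 0`, then the unique
continuous solution `(g,h)` of (★) is `C¹` (on `[0,τ_R]` resp. `[0,τ_R]×[-d,0]`) and solves:
`g'(t) - β g(t) + h(t,0) + 1 = 0` on `[0,τ_R)`;
`-(r+δ) h + ∂_t h - ∂_ζ h + g φ = 0` on `(0,τ_R) × (-d,0)`;
`g ≡ 0` on `[τ_R,∞)`; `h ≡ 0` on `[τ_R,∞) × [-d,0]`; and `h(·,-d) ≡ 0`. -/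
theorem solution_C1_and_PDE
    (d τR β r δ : ℝ) (hd : 0 < d) (hτR : 0 < τR) (φ : ℝ → ℝ)
    (hφC1 : ContDiffOn ℝ 1 φ (Icc (-d) 0)) (hφd : φ (-d) = 0)
    (g : ℝ → ℝ) (h : ℝ → ℝ → ℝ)
    (hsol : SolvesStar d τR β r δ φ g h) (hcont : ContSol d g h) :
    ContDiffOn ℝ 1 g (Icc 0 τR) ∧
    ContDiffOn ℝ 1 (Function.uncurry h) (Icc 0 τR ×ˢ Icc (-d) 0) ∧
    (∃ g' : ℝ → ℝ, ContinuousOn g' (Icc 0 τR) ∧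
      (∀ t ∈ Icc (0:ℝ) τR, HasDerivWithinAt g (g' t) (Icc 0 τR) t) ∧
      (∀ t ∈ Ico (0:ℝ) τR, g' t - β * g t + h t 0 + 1 = 0)) ∧
    (∀ t ∈ Ioo (0:ℝ) τR, ∀ ζ ∈ Ioo (-d) (0:ℝ),
      ∃ ht hζ : ℝ,
        HasDerivAt (fun s => h s ζ) ht t ∧
        HasDerivAt (fun z => h t z) hζ ζ ∧
        -((r + δ) * h t ζ) + ht - hζ + g t * φ ζ = 0) ∧
    (∀ t : ℝ, τR ≤ t → g t = 0) ∧
    (∀ t : ℝ, τR ≤ t → ∀ ζ ∈ Icc (-d) (0:ℝ), h t ζ = 0) ∧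
    (∀ t : ℝ, 0 ≤ t → h t (-d) = 0) := by
  have hzero : (0 : ℝ) ∈ Icc (-d) 0 := ⟨by linarith, le_rfl⟩
  obtain ⟨hgc, hhc⟩ := hcont
  have hh0 : ContinuousOn (fun t => h t 0) (Ici 0) :=
    hhc.comp (f := fun t => (t, (0 : ℝ))) (by fun_prop) fun t ht => ⟨ht, hzero⟩
  obtain ⟨Φ, hΦ, hΦφ⟩ := hφC1.exists_contDiff_eqOn_Icc (by linarith)
  obtain ⟨G, hG, hgG, hGd⟩ := hsol.exists_g_extension hh0
  have hK : Continuous fun u => Real.exp (-((r + δ) * u)) * g (max u 0) :=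
    (by fun_prop : Continuous fun u => Real.exp (-((r + δ) * u))).mul
      (hgc.comp_continuous (by fun_prop) fun u => le_max_right u 0)
  have hconv : ∀ {t ζ : ℝ}, 0 ≤ t → ζ ∈ Icc (-d) 0 → h t ζ = convolutionForm (r + δ) d
      (fun u => Real.exp (-((r + δ) * u)) * g (max u 0)) Φ (t, ζ) :=
    hsol.h_eq_convolutionForm hτR.le hgc hΦ.continuous hΦφ
  refine ⟨hG.contDiffOn.congr hgG,
    (contDiff_convolutionForm (r + δ) d hK hΦ).contDiffOn.congr fun p hp => hconv hp.1.1 hp.2,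
    ⟨fun t => β * g t - (h t 0 + 1), ?_, fun t ht =>
      (hGd t ht).hasDerivWithinAt.congr hgG (hgG ht), fun t _ => by ring⟩,
    fun t ht ζ hζ => ?_, fun t => hsol.g_eq_zero hτR.le,
    fun t ht ζ hζ => hsol.h_eq_zero hτR.le ht hζ, fun t => hsol.h_neg_d hd.le⟩
  · have hsub : Icc 0 τR ⊆ Ici (0 : ℝ) := Icc_subset_Ici_self
    exact ((hgc.mono hsub).const_mul β).sub ((hh0.mono hsub).add continuousOn_const)
  · have hζ' := Ioo_subset_Icc_self hζ
    obtain ⟨ht', hζd, hdt, hdζ, hpde⟩ := convolutionForm_transport (r + δ) d hK hΦ t ζ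
    refine ⟨ht', hζd, hdt.congr_of_eventuallyEq ?_, hdζ.congr_of_eventuallyEq ?_, ?_⟩
    · filter_upwards [Ioi_mem_nhds ht.1] with s hs using hconv (le_of_lt hs) hζ'
    · filter_upwards [Ioo_mem_nhds hζ.1 hζ.2] with z hz
        using hconv ht.1.le (Ioo_subset_Icc_self hz)
    · have hone : Real.exp ((r + δ) * t) * Real.exp (-((r + δ) * t)) = 1 := by
        rw [← Real.exp_add, add_neg_cancel, Real.exp_zero]
      rw [max_eq_left ht.1.le, hΦφ hζ', ← hconv ht.1.le hζ'] at hpde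
      linear_combination hpde - g t * φ ζ * hone
end

section
/- Suppose p₀ > 0 and P₁₁ < 0. Then the supremum of H_cv(c,B,θ) over (c,B,θ) ∈ (0,∞)×(0,∞)×ℝⁿ is attained at the unique point c* = e^{−(ρ+δ)t/γ} p₀^{−1/γ}, B* = k^{−b} e^{−(ρ+δ)t/γ} p₀^{−1/γ}, θ* = −(1/P₁₁) (σσᵀ)^{−1} [ (μ − r𝟙) p₀ + x₀ P₁₂ σσ_y ], and the supremum equals (γ/(1−γ)) e^{−(ρ+δ)t/γ} (1 + δ k^{−b}) p₀^{b} − (1/(2P₁₁)) [ (μ − r𝟙) p₀ + x₀ P₁₂ σσ_y ]ᵀ (σσᵀ)^{−1} [ (μ − r𝟙) p₀ + x₀ P₁₂ σσ_y ]. -/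
open Matrix

/-- The control part of the Hamiltonian:
`H_cv(c,B,θ) = [e^{-(ρ+δ)t} c^{1-γ}/(1-γ) - c p₀] + δ [e^{-(ρ+δ)t} k^{1-γ} B^{1-γ}/(1-γ) - B p₀]
 + [(1/2) θᵀσσᵀθ P₁₁ + θᵀσσ_y x₀ P₁₂ + θᵀ(μ - r𝟙) p₀]`. -/
noncomputable def Hcv {n : ℕ} (σ : Matrix (Fin n) (Fin n) ℝ) (μv σy : Fin n → ℝ)
    (r ρ δ k γ t x₀ p₀ P₁₁ P₁₂ : ℝ) (c B : ℝ) (θ : Fin n → ℝ) : ℝ :=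
  (Real.exp (-((ρ + δ) * t)) * c ^ (1 - γ) / (1 - γ) - c * p₀)
    + δ * (Real.exp (-((ρ + δ) * t)) * k ^ (1 - γ) * B ^ (1 - γ) / (1 - γ) - B * p₀)
    + ((1 / 2) * (θ ⬝ᵥ (σ * σᵀ).mulVec θ) * P₁₁
        + (θ ⬝ᵥ σ.mulVec σy) * x₀ * P₁₂
        + (θ ⬝ᵥ fun i => μv i - r) * p₀)

/-- Bernoulli's inequality `x ^ γ ≷ 1 + γ (x - 1)`, divided by `1 - γ` so that a single
inequality covers both `γ < 1` and `1 < γ`. -/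
lemma rpow_div_one_sub_lt {x γ : ℝ} (hx : 0 < x) (hx1 : x ≠ 1) (hγ0 : 0 < γ) (hγ1 : γ ≠ 1) :
    x ^ γ / (1 - γ) < (1 + γ * (x - 1)) / (1 - γ) := by
  have hs : -1 ≤ x - 1 := by linarith
  have hs' : x - 1 ≠ 0 := sub_ne_zero.mpr hx1
  rcases lt_or_gt_of_ne hγ1 with h | h
  · have := rpow_one_add_lt_one_add_mul_self hs hs' hγ0 h
    rw [add_sub_cancel] at this
    exact div_lt_div_of_pos_right this (by linarith)
  · have := one_add_mul_self_lt_rpow_one_add hs hs' h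
    rw [add_sub_cancel] at this
    exact div_lt_div_of_neg_of_lt (by linarith) this

lemma rpow_one_sub_eq_mul_rpow_neg {s : ℝ} (hs : 0 < s) (γ : ℝ) :
    s ^ (1 - γ) = s * s ^ (-γ) := by
  rw [sub_eq_add_neg, Real.rpow_add hs, Real.rpow_one]

/-- A power utility net of a linear cost is maximised only where marginal utility equals the
price. -/
lemma powerUtility_sub_mul_lt {A p s c γ : ℝ} (hA : 0 < A) (hs : 0 < s) (hc : 0 < c)
    (hγ0 : 0 < γ) (hγ1 : γ ≠ 1) (hp : A * s ^ (-γ) = p) (hcs : c ≠ s) :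
    A * c ^ (1 - γ) / (1 - γ) - c * p < A * s ^ (1 - γ) / (1 - γ) - s * p := by
  have hγ : 1 - γ ≠ 0 := sub_ne_zero.mpr hγ1.symm
  have hx1 : s / c ≠ 1 := fun h => hcs ((div_eq_one_iff_eq hc.ne').mp h).symm
  have hS : 0 < s ^ (-γ) := Real.rpow_pos_of_pos hs _
  have hC : c ^ (-γ) = s ^ (-γ) * (s / c) ^ γ := by
    rw [Real.div_rpow hs.le hc.le, Real.rpow_neg hs.le, Real.rpow_neg hc.le]
    have := (Real.rpow_pos_of_pos hs γ).ne'
    field_simp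
  have key := mul_lt_mul_of_pos_left (rpow_div_one_sub_lt (div_pos hs hc) hx1 hγ0 hγ1)
    (mul_pos (mul_pos hA hS) hc)
  rw [rpow_one_sub_eq_mul_rpow_neg hc, rpow_one_sub_eq_mul_rpow_neg hs, hC, ← hp]
  calc
    _ = A * s ^ (-γ) * c * ((s / c) ^ γ / (1 - γ)) - c * (A * s ^ (-γ)) := by ring
    _ < A * s ^ (-γ) * c * ((1 + γ * (s / c - 1)) / (1 - γ)) - c * (A * s ^ (-γ)) := by
      linarith
    _ = _ := by
      field_simp
      ring

lemma powerUtility_sub_mul_eq {A p s γ : ℝ} (hs : 0 < s) (hγ1 : γ ≠ 1)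
    (hp : A * s ^ (-γ) = p) :
    A * s ^ (1 - γ) / (1 - γ) - s * p = γ / (1 - γ) * (s * p) := by
  have hγ : 1 - γ ≠ 0 := sub_ne_zero.mpr hγ1.symm
  rw [rpow_one_sub_eq_mul_rpow_neg hs, ← hp]
  field_simp
  ring

/-- Completing the square for a quadratic form with Gram matrix `σ * σᵀ`. -/
lemma quadratic_eq_add_sq {n : ℕ} (σ : Matrix (Fin n) (Fin n) ℝ) {v θs : Fin n → ℝ} {P : ℝ}
    (hθs : P • (σ * σᵀ) *ᵥ θs = -v) (θ : Fin n → ℝ) :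
    1 / 2 * (θ ⬝ᵥ (σ * σᵀ) *ᵥ θ) * P + θ ⬝ᵥ v
      = 1 / 2 * (θs ⬝ᵥ v) + P / 2 * ((θ - θs) ᵥ* σ ⬝ᵥ (θ - θs) ᵥ* σ) := by
  have gram (x y : Fin n → ℝ) : x ⬝ᵥ (σ * σᵀ) *ᵥ y = x ᵥ* σ ⬝ᵥ y ᵥ* σ := by
    rw [← mulVec_mulVec, mulVec_transpose, dotProduct_mulVec]
  obtain rfl : v = -(P • (σ * σᵀ) *ᵥ θs) := by rw [hθs, neg_neg]
  simp only [dotProduct_neg, dotProduct_smul, gram, sub_vecMul, sub_dotProduct, dotProduct_sub,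
    smul_eq_mul]
  rw [dotProduct_comm (θs ᵥ* σ) (θ ᵥ* σ)]
  ring

/-- If `p₀ > 0` and `P₁₁ < 0`, the supremum of `H_cv` over
`(c,B,θ) ∈ (0,∞)×(0,∞)×ℝⁿ` is attained at the unique point
`c* = e^{-(ρ+δ)t/γ} p₀^{-1/γ}`, `B* = k^{-b} e^{-(ρ+δ)t/γ} p₀^{-1/γ}`,
`θ* = -(1/P₁₁)(σσᵀ)⁻¹ [(μ - r𝟙)p₀ + x₀ P₁₂ σσ_y]`, and the supremum equals
`(γ/(1-γ)) e^{-(ρ+δ)t/γ} (1 + δ k^{-b}) p₀^b - (1/(2P₁₁)) vᵀ (σσᵀ)⁻¹ v`, with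
`v = (μ - r𝟙)p₀ + x₀ P₁₂ σσ_y` and `b = 1 - 1/γ`. -/
theorem hamiltonian_sup_attained
    (n : ℕ) (hn : 1 ≤ n) (σ : Matrix (Fin n) (Fin n) ℝ) (hσ : IsUnit σ.det)
    (μv σy : Fin n → ℝ) (r ρ δ k γ t x₀ p₀ P₁₁ P₁₂ : ℝ)
    (hρ : 0 < ρ) (hδ : 0 < δ) (hk : 0 < k) (hγ0 : 0 < γ) (hγ1 : γ ≠ 1)
    (ht : 0 ≤ t) (hp₀ : 0 < p₀) (hP₁₁ : P₁₁ < 0) :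
    let b : ℝ := 1 - 1 / γ
    let cs : ℝ := Real.exp (-((ρ + δ) * t) / γ) * p₀ ^ (-(1 / γ))
    let Bs : ℝ := k ^ (-b) * (Real.exp (-((ρ + δ) * t) / γ) * p₀ ^ (-(1 / γ)))
    let v : Fin n → ℝ := fun i => p₀ * (μv i - r) + (x₀ * P₁₂) * (σ.mulVec σy) i
    let θs : Fin n → ℝ := fun i => -(1 / P₁₁) * ((σ * σᵀ)⁻¹.mulVec v) i
    0 < cs ∧ 0 < Bs ∧
    (∀ (c B : ℝ) (θ : Fin n → ℝ), 0 < c → 0 < B →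
      Hcv σ μv σy r ρ δ k γ t x₀ p₀ P₁₁ P₁₂ c B θ
        ≤ Hcv σ μv σy r ρ δ k γ t x₀ p₀ P₁₁ P₁₂ cs Bs θs) ∧
    (∀ (c B : ℝ) (θ : Fin n → ℝ), 0 < c → 0 < B →
      Hcv σ μv σy r ρ δ k γ t x₀ p₀ P₁₁ P₁₂ c B θ
          = Hcv σ μv σy r ρ δ k γ t x₀ p₀ P₁₁ P₁₂ cs Bs θs →
        c = cs ∧ B = Bs ∧ θ = θs) ∧
    Hcv σ μv σy r ρ δ k γ t x₀ p₀ P₁₁ P₁₂ cs Bs θs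
      = γ / (1 - γ) * Real.exp (-((ρ + δ) * t) / γ) * (1 + δ * k ^ (-b)) * p₀ ^ b
        - 1 / (2 * P₁₁) * (v ⬝ᵥ (σ * σᵀ)⁻¹.mulVec v) := by
  intro b cs Bs v θs
  set E := Real.exp (-((ρ + δ) * t)) with hE
  have hE0 : 0 < E := Real.exp_pos _
  have hEγ : Real.exp (-((ρ + δ) * t) / γ) = E ^ (1 / γ) := by
    rw [hE, ← Real.exp_mul, mul_one_div]
  have hcs0 : 0 < cs := by positivity
  have hBs0 : 0 < Bs := by positivity
  have hcsγ : cs ^ (-γ) = E⁻¹ * p₀ := by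
    simp only [cs]
    rw [hEγ, Real.mul_rpow (by positivity) (by positivity), ← Real.rpow_mul hE0.le,
      ← Real.rpow_mul hp₀.le, ← Real.rpow_neg_one]
    congr 2 <;> field_simp
    simp
  have hc_foc : E * cs ^ (-γ) = p₀ := by
    rw [hcsγ, mul_inv_cancel_left₀ hE0.ne']
  have hB_foc : E * k ^ (1 - γ) * Bs ^ (-γ) = p₀ := by
    change E * k ^ (1 - γ) * (k ^ (-b) * cs) ^ (-γ) = p₀
    have hexp : -b * -γ = -(1 - γ) := by
      simp only [b]
      field_simp
      ring
    rw [Real.mul_rpow (by positivity) hcs0.le, ← Real.rpow_mul hk.le, hexp, Real.rpow_neg hk.le,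
      hcsγ]
    have := (Real.rpow_pos_of_pos hk (1 - γ)).ne'
    field_simp
  have hEk : 0 < E * k ^ (1 - γ) := by positivity
  have hdet : IsUnit (σ * σᵀ).det := by
    rw [det_mul, det_transpose]
    exact hσ.mul hσ
  have hθs_eq : θs = (-(1 / P₁₁)) • (σ * σᵀ)⁻¹ *ᵥ v := rfl
  have hθ_foc : P₁₁ • (σ * σᵀ) *ᵥ θs = -v := by
    rw [hθs_eq, mulVec_smul, mulVec_mulVec, mul_nonsing_inv _ hdet, one_mulVec, smul_smul]
    have : P₁₁ * -(1 / P₁₁) = -1 := by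
      field_simp [hP₁₁.ne]
    rw [this, neg_one_smul]
  have hsplit (c B : ℝ) (θ : Fin n → ℝ) :
      Hcv σ μv σy r ρ δ k γ t x₀ p₀ P₁₁ P₁₂ c B θ
        = (E * c ^ (1 - γ) / (1 - γ) - c * p₀)
          + δ * (E * k ^ (1 - γ) * B ^ (1 - γ) / (1 - γ) - B * p₀)
          + (1 / 2 * (θs ⬝ᵥ v) + P₁₁ / 2 * ((θ - θs) ᵥ* σ ⬝ᵥ (θ - θs) ᵥ* σ)) := by
    have hv : v = p₀ • (fun i => μv i - r) + (x₀ * P₁₂) • σ *ᵥ σy := rfl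
    rw [← quadratic_eq_add_sq σ hθ_foc θ, hv]
    simp only [Hcv, dotProduct_add, dotProduct_smul, smul_eq_mul, ← hE]
    ring
  have hsq_nonneg (θ : Fin n → ℝ) : 0 ≤ (θ - θs) ᵥ* σ ⬝ᵥ (θ - θs) ᵥ* σ :=
    Finset.sum_nonneg fun i _ => mul_self_nonneg _
  have hc_le (c : ℝ) (hc : 0 < c) :
      E * c ^ (1 - γ) / (1 - γ) - c * p₀ ≤ E * cs ^ (1 - γ) / (1 - γ) - cs * p₀ := by
    rcases eq_or_ne c cs with rfl | h
    · exact le_rfl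
    · exact (powerUtility_sub_mul_lt hE0 hcs0 hc hγ0 hγ1 hc_foc h).le
  have hB_le (B : ℝ) (hB : 0 < B) :
      E * k ^ (1 - γ) * B ^ (1 - γ) / (1 - γ) - B * p₀
        ≤ E * k ^ (1 - γ) * Bs ^ (1 - γ) / (1 - γ) - Bs * p₀ := by
    rcases eq_or_ne B Bs with rfl | h
    · exact le_rfl
    · exact (powerUtility_sub_mul_lt hEk hBs0 hB hγ0 hγ1 hB_foc h).le
  refine ⟨hcs0, hBs0, fun c B θ hc hB => ?_, fun c B θ hc hB heq => ?_, ?_⟩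
  · rw [hsplit, hsplit, sub_self, zero_vecMul, zero_dotProduct]
    have := mul_le_mul_of_nonneg_left (hB_le B hB) hδ.le
    linarith [hc_le c hc, mul_nonneg (neg_nonneg.mpr hP₁₁.le) (hsq_nonneg θ)]
  · rw [hsplit, hsplit, sub_self, zero_vecMul, zero_dotProduct] at heq
    have hc1 := hc_le c hc
    have hB1 := mul_le_mul_of_nonneg_left (hB_le B hB) hδ.le
    have hθ1 := mul_nonneg (neg_nonneg.mpr hP₁₁.le) (hsq_nonneg θ)
    refine ⟨?_, ?_, ?_⟩
    · by_contra h
      linarith [powerUtility_sub_mul_lt hE0 hcs0 hc hγ0 hγ1 hc_foc h]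
    · by_contra h
      linarith [mul_lt_mul_of_pos_left
        (powerUtility_sub_mul_lt hEk hBs0 hB hγ0 hγ1 hB_foc h) hδ]
    · have hzero : P₁₁ * ((θ - θs) ᵥ* σ ⬝ᵥ (θ - θs) ᵥ* σ) = 0 := by linarith
      have hvec := dotProduct_self_eq_zero.mp ((mul_eq_zero.mp hzero).resolve_left hP₁₁.ne)
      exact sub_eq_zero.mp (eq_zero_of_vecMul_eq_zero hσ.ne_zero hvec)
  · rw [hsplit, sub_self, zero_vecMul, zero_dotProduct, powerUtility_sub_mul_eq hcs0 hγ1 hc_foc,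
      powerUtility_sub_mul_eq hBs0 hγ1 hB_foc, hθs_eq, smul_dotProduct, smul_eq_mul,
      dotProduct_comm _ v]
    have hpb : p₀ ^ b = p₀ ^ (-(1 / γ)) * p₀ := by
      rw [← Real.rpow_add_one hp₀.ne']
      congr 1
      simp only [b]
      ring
    rw [hpb]
    simp only [cs, Bs]
    ring
end

section
/- The function f satisfies f(t) > 0 for all t ∈ [0,τ_R], f(τ_R) = η̂, and f′(t) = (f(t) − η)/ν for all t ∈ [0,τ_R]; consequently, the function F(t) := e^{−(ρ+δ)t/γ} f(t) satisfies, for every t ∈ [0,τ_R], the identity (γ/(1−γ)) F′(t)/F(t) + (r + δ) + (γ/(1−γ)) e^{−(ρ+δ)t/γ} F(t)^{−1} (1 + δ k^{−b}) + κᵀκ/(2γ) = 0. -/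
open Matrix Set

theorem affine_interpolation_pos {a c x : ℝ} (ha : 0 ≤ a) (hc : 0 < c) (hx0 : 0 < x)
    (hx1 : x ≤ 1) : 0 < (c - a) * x + a := by
  nlinarith [mul_pos hc hx0, mul_nonneg ha (sub_nonneg.2 hx1)]

theorem hasDerivAt_exp_relaxation (c a ν T t : ℝ) :
    HasDerivAt (fun s => c * Real.exp (-(T - s) / ν) + a)
      ((c * Real.exp (-(T - t) / ν) + a - a) / ν) t := by
  have h : HasDerivAt (fun s : ℝ => -(T - s) / ν) (1 / ν) t := by
    simpa using ((hasDerivAt_id t).const_sub T).neg.div_const ν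
  exact ((h.exp.const_mul c).add_const a).congr_deriv (by ring)

theorem hasDerivAt_discounted (m γ : ℝ) {f : ℝ → ℝ} {f' t : ℝ} (hf : HasDerivAt f f' t) :
    HasDerivAt (fun s => Real.exp (-(m * s) / γ) * f s)
      (Real.exp (-(m * t) / γ) * (f' - m / γ * f t)) t := by
  have h : HasDerivAt (fun s : ℝ => -(m * s) / γ) (-m / γ) t := by
    simpa using ((hasDerivAt_id t).const_mul m).neg.div_const γ
  exact (h.exp.mul hf).congr_deriv (by ring)

/-- With `ν = γ/(ρ+δ-(1-γ)(r+δ+κᵀκ/(2γ)))`, `η = (1+δk^{-b})ν`,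
`η̂ = (K^{-b}+δk^{-b})ν` and `f(t) = (η̂-η)e^{-(τ_R-t)/ν} + η`, the function `f` is positive
on `[0,τ_R]`, satisfies `f(τ_R) = η̂` and `f'(t) = (f(t)-η)/ν`; consequently
`F(t) = e^{-(ρ+δ)t/γ} f(t)` satisfies, for every `t ∈ [0,τ_R]`,
`(γ/(1-γ)) F'(t)/F(t) + (r+δ) + (γ/(1-γ)) e^{-(ρ+δ)t/γ} F(t)⁻¹ (1+δk^{-b}) + κᵀκ/(2γ) = 0`. -/
theorem f_ode_and_F_identity
    (n : ℕ) (τR r ρ δ k K γ : ℝ) (κ : Fin n → ℝ)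
    (hτR : 0 < τR) (hρ : 0 < ρ) (hδ : 0 < δ) (hk : 0 < k) (hK : 0 < K)
    (hγ0 : 0 < γ) (hγ1 : γ ≠ 1)
    (hpos : 0 < ρ + δ - (1 - γ) * (r + δ + (κ ⬝ᵥ κ) / (2 * γ))) :
    let b : ℝ := 1 - 1 / γ
    let ν : ℝ := γ / (ρ + δ - (1 - γ) * (r + δ + (κ ⬝ᵥ κ) / (2 * γ)))
    let η : ℝ := (1 + δ * k ^ (-b)) * ν
    let ηh : ℝ := (K ^ (-b) + δ * k ^ (-b)) * ν
    let f : ℝ → ℝ := fun t => (ηh - η) * Real.exp (-(τR - t) / ν) + η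
    let F : ℝ → ℝ := fun t => Real.exp (-((ρ + δ) * t) / γ) * f t
    (∀ t ∈ Icc (0:ℝ) τR, 0 < f t) ∧
    f τR = ηh ∧
    (∀ t ∈ Icc (0:ℝ) τR, HasDerivAt f ((f t - η) / ν) t) ∧
    (∀ t ∈ Icc (0:ℝ) τR, ∃ F' : ℝ, HasDerivAt F F' t ∧
      γ / (1 - γ) * (F' / F t) + (r + δ)
        + γ / (1 - γ) * Real.exp (-((ρ + δ) * t) / γ) * (F t)⁻¹ * (1 + δ * k ^ (-b))
        + (κ ⬝ᵥ κ) / (2 * γ) = 0) := by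
  intro b ν η ηh f F
  have hν : 0 < ν := div_pos hγ0 hpos
  have hkb : 0 < k ^ (-b) := Real.rpow_pos_of_pos hk _
  have hKb : 0 < K ^ (-b) := Real.rpow_pos_of_pos hK _
  have hη : 0 < η := by positivity
  have hηh : 0 < ηh := by positivity
  have hf_pos : ∀ t ∈ Icc (0:ℝ) τR, 0 < f t := fun t ht =>
    affine_interpolation_pos hη.le hηh (Real.exp_pos _)
      (Real.exp_le_one_iff.2
        (div_nonpos_of_nonpos_of_nonneg (by linarith [ht.2]) hν.le))
  have hf_deriv : ∀ t, HasDerivAt f ((f t - η) / ν) t := fun t =>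
    hasDerivAt_exp_relaxation (ηh - η) η ν τR t
  refine ⟨hf_pos, by simp [f], fun t _ => hf_deriv t, fun t ht => ⟨_,
    hasDerivAt_discounted (ρ + δ) γ (hf_deriv t), ?_⟩⟩
  have h1γ : 1 - γ ≠ 0 := sub_ne_zero.2 hγ1.symm
  have hft : f t ≠ 0 := (hf_pos t ht).ne'
  have hν_inv : γ / ν = ρ + δ - (1 - γ) * (r + δ + (κ ⬝ᵥ κ) / (2 * γ)) :=
    div_div_cancel₀ hγ0.ne'
  have hην : 1 + δ * k ^ (-b) = η / ν := (mul_div_cancel_right₀ _ hν.ne').symm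
  have hF : F t = Real.exp (-((ρ + δ) * t) / γ) * f t := rfl
  rw [hF, hην]
  have he := (Real.exp_pos (-((ρ + δ) * t) / γ)).ne'
  generalize Real.exp (-((ρ + δ) * t) / γ) = e at he ⊢
  have hlog : γ / (1 - γ) * (e * ((f t - η) / ν - (ρ + δ) / γ * f t) / (e * f t))
      + γ / (1 - γ) * e * (e * f t)⁻¹ * (η / ν) = (γ / ν - (ρ + δ)) / (1 - γ) := by
    have hν0 := hν.ne'
    clear_value f ν η
    field_simp
    ring
  have hquot : (γ / ν - (ρ + δ)) / (1 - γ) = -(r + δ + (κ ⬝ᵥ κ) / (2 * γ)) := by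
    rw [hν_inv, div_eq_iff h1γ]
    ring
  linarith
end
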